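/- The T-Q relation holds: for every u ∈ ℂ, Σ_{a=0}^{N} (−1)^a Q_1(u + a)·T^{(a)}_1(u + a/2) = 0 in K. -/

import Mathlib

attribute [local instance 10] Classical.propDecidable

noncomputable section

open Finset

variable {K : Type*} [CommRing K]

/-- `Y_a(u)` as a unit of `K`, with `Y_0(u) = 1`, where
`Y_a(u) = Q_a(u - d_a) Q_a(u + d_a)⁻¹`, `d_a = 1/2` for `a < n` and `d_n = 1`. -/
def Yq (n : ℕ) (Q : ℕ → ℂ → Kˣ) (a : ℕ) (u : ℂ) : Kˣ :=
  if a = 0 then 1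
  else Q a (u - (if a = n then 1 else 2⁻¹)) * (Q a (u + (if a = n then 1 else 2⁻¹)))⁻¹

/-- `z_i(u)` for `i = 1,…,2n`, where `i ≤ n` encodes the letter `i` of the alphabet
`J = {1 ≺ ⋯ ≺ n ≺ n̄ ≺ ⋯ ≺ 1̄}`, and `i > n` encodes the letter `\overline{2n+1-i}`. -/
def zq (n : ℕ) (Q : ℕ → ℂ → Kˣ) (i : ℕ) (u : ℂ) : Kˣ :=
  if i ≤ n then
    Yq n Q i (u + (i : ℂ) / 2) * (Yq n Q (i - 1) (u + ((i : ℂ) + 1) / 2))⁻¹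
  else
    Yq n Q (2 * n - i) (u + ((i : ℂ) + 2) / 2) *
      (Yq n Q (2 * n + 1 - i) (u + ((i : ℂ) + 3) / 2))⁻¹

/-- the common value `x_{n+1}(u) = -x_{n+2}(u)
  = Q_n(u+n/2) Q_n(u+(n+4)/2) Q_n(u+(n+2)/2)⁻²`. -/
def xqmid (n : ℕ) (Q : ℕ → ℂ → Kˣ) (u : ℂ) : K :=
  (Q n (u + (n : ℂ) / 2) : K) * (Q n (u + ((n : ℂ) + 4) / 2) : K) *
    (((Q n (u + ((n : ℂ) + 2) / 2))⁻¹ : Kˣ) : K) ^ 2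

/-- `x_i(u)` for `i = 1,…,N = 2n+2`. -/
def xq (n : ℕ) (Q : ℕ → ℂ → Kˣ) (i : ℕ) (u : ℂ) : K :=
  if i ≤ n then zq n Q i u
  else if i = n + 1 then xqmid n Q u
  else if i = n + 2 then -xqmid n Q u
  else zq n Q (i - 2) u

/-- admissibility of a column tableau: whenever `i_k = c` and `i_l = \bar c`
for some `1 ≤ c ≤ n`, one has `n + k - l ≥ c` (letters encoded as in `zq`,
positions `0`-based, which does not change the difference `k - l`). -/
def AdmQ (n : ℕ) {a : ℕ} (t : Fin a → Fin (2 * n)) : Prop :=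
  ∀ k l : Fin a, ((t k : ℕ) + 1 ≤ n) → ((t l : ℕ) + 1 = 2 * n + 1 - ((t k : ℕ) + 1)) →
    (((t k : ℕ) + 1 : ℤ)) ≤ (n : ℤ) + (k : ℕ) - (l : ℕ)

/-- the column tableau sum: `tabSumQ n Q a v = T^{(a)}_1(v)` for `0 ≤ a ≤ n`, i.e.
`T^{(a)}_1(u + 1/2) = ∑ z_{i_1}(u + (a-1)/2) ⋯ z_{i_a}(u - (a-1)/2)` over strictly
increasing admissible tableaux. -/
def tabSumQ (n : ℕ) (Q : ℕ → ℂ → Kˣ) (a : ℕ) (v : ℂ) : K :=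
  ∑ t ∈ univ.filter (fun t : Fin a → Fin (2 * n) => StrictMono t ∧ AdmQ n t),
    ∏ k : Fin a,
      (zq n Q ((t k : ℕ) + 1) (v + ((a : ℂ) - 2 * (((k : ℕ) : ℂ) + 1)) / 2) : K)

/-- `T^{(a)}_1(v)` for all `a ∈ ℤ`: the fundamental `q`-characters for `1 ≤ a ≤ n`,
extended by `T^{(0)}_1 = 1`, `T^{(a)}_1 = 0` for `a < 0`, and
`T^{(a)}_1(u) + T^{(N-a)}_1(u) = 0`. -/
def T1q (n : ℕ) (Q : ℕ → ℂ → Kˣ) (a : ℤ) (v : ℂ) : K :=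
  if a < 0 then 0
  else if a ≤ (n : ℤ) then tabSumQ n Q a.toNat v
  else if a = (n : ℤ) + 1 then 0
  else if a ≤ 2 * (n : ℤ) + 2 then -tabSumQ n Q (2 * (n : ℤ) + 2 - a).toNat v
  else 0

/-- left-to-right composition of a list of difference operators. -/
def opProd (l : List ((ℂ → K) → (ℂ → K))) : (ℂ → K) → (ℂ → K) :=
  l.foldr (· ∘ ·) id

/-- the operator `L(u) = (M_{x_1(⋅+n)} - D)(M_{x_2(⋅+n-1)} - D) ⋯ (M_{x_N(⋅+n+1-N)} - D)`,
where `D` is the shift `(Df)(u) = f(u+1)` and `M_g` is multiplication by `g`. -/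
def Lq (n : ℕ) (Q : ℕ → ℂ → Kˣ) : (ℂ → K) → (ℂ → K) :=
  opProd ((List.range (2 * n + 2)).map fun j =>
    fun f u => xq n Q (j + 1) (u + (n : ℂ) - (j : ℂ)) * f u - f (u + 1))

/-- `ε_i = -1` for `i = n+1, n+2` and `= 1` otherwise. -/
def epsq (n : ℕ) (i : ℕ) : K := if i = n + 1 ∨ i = n + 2 then -1 else 1

/-- `L_j`, the left-to-right composition over `i = N+1-j, …, N` of the operators
`D - ε_i M_{x_i(⋅+n+1-i)}`. -/
def Ljq (n : ℕ) (Q : ℕ → ℂ → Kˣ) (j : ℕ) : (ℂ → K) → (ℂ → K) :=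
  opProd ((List.range j).map fun r =>
    fun f u => f (u + 1) -
      epsq n (2 * n + 3 - j + r) * xq n Q (2 * n + 3 - j + r)
        (u + (n : ℂ) + 1 - ((2 * n + 3 - j + r : ℕ) : ℂ)) * f u)

/-- the Casorati determinant `det_{1 ≤ r,s ≤ j} (w_r(u + s - 1))`
(for a family `w` indexed by `1, 2, …`). -/
def casq (w : ℕ → ℂ → K) (j : ℕ) (u : ℂ) : K :=
  Matrix.det (Matrix.of fun r s : Fin j => w ((r : ℕ) + 1) (u + ((s : ℕ) : ℂ)))

/-- `ξ^{(a)}_m(u)`: the determinant of the `N × N` matrix whose columns are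
`(w_j(u+c))_j` for `c` running over `(0, 1, …, a-1, a+m, a+m+1, …, N+m-1)`. -/
def xiq (n : ℕ) (w : ℕ → ℂ → K) (a m : ℕ) (u : ℂ) : K :=
  Matrix.det (Matrix.of fun j r : Fin (2 * n + 2) =>
    w ((j : ℕ) + 1) (u + ((if (r : ℕ) < a then (r : ℕ) else (r : ℕ) + m : ℕ) : ℂ)))

/-- `Y_a(u + a/2)`, the building block of the letters `z_i`. -/
def shiftedY (n : ℕ) (Q : ℕ → ℂ → Kˣ) (a : ℕ) (u : ℂ) : Kˣ :=
  Yq n Q a (u + (a : ℂ) / 2)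

theorem zq_unbarred (n : ℕ) (Q : ℕ → ℂ → Kˣ) {m : ℕ} (hm : m < n) (u : ℂ) :
    zq n Q (n - m) u =
      shiftedY n Q (n - m) u * (shiftedY n Q (n - (m + 1)) (u + 1))⁻¹ := by
  obtain ⟨c, rfl⟩ : ∃ c, n = c + 1 + m := ⟨n - m - 1, by omega⟩
  have h1 : c + 1 + m - m = c + 1 := by omega
  have h2 : c + 1 + m - (m + 1) = c := by omega
  rw [h1, h2, zq, if_pos (by omega), shiftedY, shiftedY, Nat.add_sub_cancel]
  congr 3
  push_cast
  ring

theorem zq_barred (n : ℕ) (Q : ℕ → ℂ → Kˣ) {m : ℕ} (hm : m < n) (u : ℂ) :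
    zq n Q (n + m + 1) u =
      shiftedY n Q (n - (m + 1)) (u + m + 2) * (shiftedY n Q (n - m) (u + m + 2))⁻¹ := by
  obtain ⟨c, rfl⟩ : ∃ c, n = c + 1 + m := ⟨n - m - 1, by omega⟩
  have h1 : c + 1 + m - m = c + 1 := by omega
  have h2 : c + 1 + m - (m + 1) = c := by omega
  have h3 : 2 * (c + 1 + m) - (c + 1 + m + m + 1) = c := by omega
  have h4 : 2 * (c + 1 + m) + 1 - (c + 1 + m + m + 1) = c + 1 := by omega
  have e1 : u + (((c + 1 + m + m + 1 : ℕ) : ℂ) + 2) / 2 = u + m + 2 + (c : ℂ) / 2 := by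
    push_cast
    ring
  have e2 : u + (((c + 1 + m + m + 1 : ℕ) : ℂ) + 3) / 2
      = u + m + 2 + ((c + 1 : ℕ) : ℂ) / 2 := by
    push_cast
    ring
  rw [h1, h2, zq, if_neg (by omega), shiftedY, shiftedY, h3, h4, e1, e2]

theorem shiftedY_zero (n : ℕ) (Q : ℕ → ℂ → Kˣ) (u : ℂ) : shiftedY n Q 0 u = 1 := by
  simp [shiftedY, Yq]

/-- The noncommutative elementary symmetric function in the `m` innermost pairs of letters
together with the two middle letters, for the spectral parameter `u` of the first box.
The middle letters contribute only as an adjacent pair. -/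
def elemQ (n : ℕ) (Q : ℕ → ℂ → Kˣ) : ℕ → ℤ → ℂ → K
  | 0, a, u =>
    if a = 0 then 1
    else if a = 2 then -((shiftedY n Q n u * (shiftedY n Q n (u + 1))⁻¹ : Kˣ) : K)
    else 0
  | m + 1, a, u =>
    elemQ n Q m a u + zq n Q (n - m) u * elemQ n Q m (a - 1) (u - 1)
      + elemQ n Q m (a - 1) u * zq n Q (n + m + 1) (u - a + 1)
      + zq n Q (n - m) u * elemQ n Q m (a - 2) (u - 1) * zq n Q (n + m + 1) (u - a + 1)

theorem elemQ_of_neg (n : ℕ) (Q : ℕ → ℂ → Kˣ) (m : ℕ) :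
    ∀ (a : ℤ) (_ : a < 0) (u : ℂ), elemQ n Q m a u = 0 := by
  induction m with
  | zero =>
    intro a ha u
    rw [elemQ, if_neg (by omega), if_neg (by omega)]
  | succ m ih =>
    intro a ha u
    rw [elemQ, ih a ha, ih (a - 1) (by omega), ih (a - 1) (by omega), ih (a - 2) (by omega)]
    ring

theorem elemQ_of_gt (n : ℕ) (Q : ℕ → ℂ → Kˣ) (m : ℕ) :
    ∀ (a : ℤ) (_ : 2 * (m : ℤ) + 2 < a) (u : ℂ), elemQ n Q m a u = 0 := by
  induction m with
  | zero =>
    intro a ha u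
    rw [elemQ, if_neg (by omega), if_neg (by omega)]
  | succ m ih =>
    intro a ha u
    push_cast at ha
    rw [elemQ, ih a (by omega), ih (a - 1) (by omega), ih (a - 1) (by omega),
      ih (a - 2) (by omega)]
    ring

/-- Antisymmetry of the elementary functions under complementing the degree. -/
theorem elemQ_antisymm (n : ℕ) (Q : ℕ → ℂ → Kˣ) (m : ℕ) (hm : m ≤ n) :
    ∀ (a : ℤ) (u : ℂ), elemQ n Q m (2 * m + 2 - a) u * shiftedY n Q (n - m) (u + 1) =
      -(elemQ n Q m a (u - m - 1 + a) * shiftedY n Q (n - m) (u - m + a)) := by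
  induction m with
  | zero =>
    intro a u
    by_cases h0 : a = 0
    · subst h0
      simp [elemQ]
    by_cases h2 : a = 2
    · subst h2
      have e1 : u + 1 + 1 = u + 2 := by ring
      have e2 : u - 1 + 2 = u + 1 := by ring
      simp [elemQ, e1, e2]
    · have h3 : (2 : ℤ) * (0 : ℕ) + 2 - a ≠ 0 := by push_cast; omega
      have h4 : (2 : ℤ) * (0 : ℕ) + 2 - a ≠ 2 := by push_cast; omega
      rw [elemQ, elemQ, if_neg h3, if_neg h4, if_neg h0, if_neg h2]
      ring
  | succ m ih =>
    intro a u
    have ih' := ih (by omega)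
    have s1 := ih' (a - 2) u
    have s2 := ih' (a - 1) (u - 1)
    have s3 := ih' (a - 1) u
    have s4 := ih' a (u - 1)
    set g : ℂ → Kˣ := shiftedY n Q (n - m) with hg
    set h : ℂ → Kˣ := shiftedY n Q (n - (m + 1)) with hh
    have hz : ∀ v, (zq n Q (n - m) v : K) = g v * ((h (v + 1))⁻¹ : Kˣ) := fun v => by
      rw [zq_unbarred n Q (by omega), Units.val_mul]
    have hzb : ∀ v, (zq n Q (n + m + 1) v : K) = h (v + m + 2) * ((g (v + m + 2))⁻¹ : Kˣ) :=
      fun v => by rw [zq_barred n Q (by omega), Units.val_mul]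
    rw [elemQ, elemQ, hz, hz, hzb, hzb]
    have i1 : (2 : ℤ) * (m : ℤ) + 2 - (a - 2) = 2 * ((m + 1 : ℕ) : ℤ) + 2 - a := by
      push_cast; ring
    have i2 : (2 : ℤ) * (m : ℤ) + 2 - (a - 1) = 2 * ((m + 1 : ℕ) : ℤ) + 2 - a - 1 := by
      push_cast; ring
    have i3 : (2 : ℤ) * (m : ℤ) + 2 - a = 2 * ((m + 1 : ℕ) : ℤ) + 2 - a - 2 := by
      push_cast; ring
    rw [i1] at s1
    rw [i2] at s2 s3
    rw [i3] at s4
    set v : ℂ := u - m - 2 + a with hv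
    have c1 : u - (m : ℂ) - 1 + ((a - 2 : ℤ) : ℂ) = v - 1 := by push_cast; rw [hv]; ring
    have c2 : u - (m : ℂ) + ((a - 2 : ℤ) : ℂ) = v := by push_cast; rw [hv]; ring
    have c3 : u - 1 - (m : ℂ) - 1 + ((a - 1 : ℤ) : ℂ) = v - 1 := by push_cast; rw [hv]; ring
    have c4 : u - 1 - (m : ℂ) + ((a - 1 : ℤ) : ℂ) = v := by push_cast; rw [hv]; ring
    have c5 : u - (m : ℂ) - 1 + ((a - 1 : ℤ) : ℂ) = v := by push_cast; rw [hv]; ring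
    have c6 : u - (m : ℂ) + ((a - 1 : ℤ) : ℂ) = v + 1 := by push_cast; rw [hv]; ring
    have c7 : u - 1 - (m : ℂ) - 1 + (a : ℂ) = v := by rw [hv]; ring
    have c8 : u - 1 - (m : ℂ) + (a : ℂ) = v + 1 := by rw [hv]; ring
    have c9 : u - 1 + 1 = u := by ring
    rw [c1, c2] at s1
    rw [c3, c4, c9] at s2
    rw [c5, c6] at s3
    rw [c7, c8, c9] at s4
    have d1 : u - ((2 * ((m + 1 : ℕ) : ℤ) + 2 - a : ℤ) : ℂ) + 1 + m + 2 = v + 1 := by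
      push_cast; rw [hv]; ring
    have d2 : u - ((m + 1 : ℕ) : ℂ) - 1 + (a : ℂ) = v := by push_cast; rw [hv]; ring
    have d3 : u - ((m + 1 : ℕ) : ℂ) + (a : ℂ) = v + 1 := by push_cast; rw [hv]; ring
    have d4 : v - (a : ℂ) + 1 + m + 2 = u + 1 := by rw [hv]; ring
    rw [d1, d2, d3, d4]
    have k1 : (h (u + 1) : K) * ((h (u + 1))⁻¹ : Kˣ) = 1 := Units.mul_inv _
    have k2 : (h (v + 1) : K) * ((h (v + 1))⁻¹ : Kˣ) = 1 := Units.mul_inv _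
    have k3 : (g (u + 1) : K) * ((g (u + 1))⁻¹ : Kˣ) = 1 := Units.mul_inv _
    have k4 : (g (v + 1) : K) * ((g (v + 1))⁻¹ : Kˣ) = 1 := Units.mul_inv _
    generalize ((h (u + 1))⁻¹ : Kˣ).val = hu' at *
    generalize ((h (v + 1))⁻¹ : Kˣ).val = hv' at *
    generalize ((g (u + 1))⁻¹ : Kˣ).val = gu' at *
    generalize ((g (v + 1))⁻¹ : Kˣ).val = gv' at *
    generalize elemQ n Q m (2 * ((m + 1 : ℕ) : ℤ) + 2 - a) u = e1 at *
    generalize elemQ n Q m (2 * ((m + 1 : ℕ) : ℤ) + 2 - a - 1) u = e2 at *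
    generalize elemQ n Q m (2 * ((m + 1 : ℕ) : ℤ) + 2 - a - 1) (u - 1) = e3 at *
    generalize elemQ n Q m (2 * ((m + 1 : ℕ) : ℤ) + 2 - a - 2) (u - 1) = e4 at *
    generalize elemQ n Q m (a - 2) (v - 1) = r1 at *
    generalize elemQ n Q m (a - 1) (v - 1) = r2 at *
    generalize elemQ n Q m (a - 1) v = r3 at *
    generalize elemQ n Q m a v = r4 at *
    generalize (g u : K) = gu at *
    generalize (g (u + 1) : K) = gu1 at *
    generalize (g v : K) = gv at *
    generalize (g (v + 1) : K) = gv1 at *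
    generalize (h (u + 1) : K) = hu1 at *
    generalize (h (v + 1) : K) = hv1 at *
    have t1 : e1 = -(r1 * gv) * gu' := by linear_combination gu' * s1 - e1 * k3
    have t3 : e2 * gv' = -r3 * gu' := by
      linear_combination gu' * gv' * s3 - e2 * gv' * k3 - r3 * gu' * k4
    have q2 : e3 * gu * hu' * hu1 = -(r2 * gv) := by
      linear_combination hu' * hu1 * s2 - r2 * gv * k1
    have q4 : e4 * gu * gv' * hu' * hu1 = -r4 := by
      linear_combination hu' * hu1 * gv' * s4 - r4 * gv1 * gv' * k1 - r4 * k4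
    linear_combination hu1 * t1 + q2 + hv1 * hu1 * t3 + hv1 * q4
      + (r2 * gv + r1 * gv * hu1 * gu') * k2

theorem elemQ_middle (n : ℕ) (Q : ℕ → ℂ → Kˣ) (m : ℕ) (hm : m ≤ n) :
    ∀ u : ℂ, elemQ n Q m (m + 1) u = 0 := by
  induction m with
  | zero =>
    intro u
    simp [elemQ]
  | succ m ih =>
    intro u
    have ih' := ih (by omega)
    have s := elemQ_antisymm n Q m (by omega) m u
    have i1 : (2 : ℤ) * m + 2 - m = ((m + 1 : ℕ) : ℤ) + 1 := by push_cast; ring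
    have i2 : ((m + 1 : ℕ) : ℤ) + 1 - 1 = (m : ℤ) + 1 := by push_cast; ring
    have i3 : ((m + 1 : ℕ) : ℤ) + 1 - 2 = (m : ℤ) := by push_cast; ring
    have c1 : u - (m : ℂ) - 1 + ((m : ℤ) : ℂ) = u - 1 := by push_cast; ring
    have c2 : u - (m : ℂ) + ((m : ℤ) : ℂ) = u := by push_cast; ring
    have c3 : u - ((((m + 1 : ℕ) : ℤ) + 1 : ℤ) : ℂ) + 1 + m + 2 = u + 1 := by push_cast; ring
    rw [i1, c1, c2] at s
    rw [elemQ, i2, i3, ih', ih', zq_unbarred n Q (by omega), zq_barred n Q (by omega), c3,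
      Units.val_mul, Units.val_mul]
    have k1 := Units.mul_inv (shiftedY n Q (n - (m + 1)) (u + 1))
    have k2 := Units.mul_inv (shiftedY n Q (n - m) (u + 1))
    linear_combination ((shiftedY n Q (n - m) (u + 1))⁻¹ : Kˣ).val * s
      - elemQ n Q m (((m + 1 : ℕ) : ℤ) + 1) u * k2
      + elemQ n Q m m (u - 1) * (shiftedY n Q (n - m) u).val
        * ((shiftedY n Q (n - m) (u + 1))⁻¹ : Kˣ).val * k1

/-- The weight of a column with set of (`0`-based) entries `s`, with first box at `u`. -/
def colWeight (n : ℕ) (Q : ℕ → ℂ → Kˣ) (u : ℂ) (s : Finset ℕ) : K :=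
  ∏ x ∈ s, (zq n Q (x + 1) (u - (#{y ∈ s | y < x} : ℂ)) : K)

/-- Admissibility of a column in terms of its set of (`0`-based) entries. -/
def ColAdm (n : ℕ) (s : Finset ℕ) : Prop :=
  ∀ x ∈ s, x < n → 2 * n - 1 - x ∈ s →
    x + 1 + #{y ∈ s | y < 2 * n - 1 - x} ≤ n + #{y ∈ s | y < x}

theorem colWeight_insert_max (n : ℕ) (Q : ℕ → ℂ → Kˣ) (u : ℂ) {s : Finset ℕ} {b : ℕ}
    (hb : ∀ x ∈ s, x < b) :
    colWeight n Q u (insert b s) = colWeight n Q u s * zq n Q (b + 1) (u - (#s : ℂ)) := by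
  have hbs : b ∉ s := fun h => lt_irrefl _ (hb b h)
  rw [colWeight, prod_insert hbs, mul_comm, filter_insert, if_neg (lt_irrefl b),
    filter_true_of_mem hb, colWeight]
  congr 1
  refine prod_congr rfl fun x hx => ?_
  rw [filter_insert, if_neg (hb x hx).not_gt]

theorem card_filter_insert_min {s : Finset ℕ} {b x : ℕ} (hb : ∀ y ∈ s, b < y) (hx : b < x) :
    #{y ∈ insert b s | y < x} = #{y ∈ s | y < x} + 1 := by
  rw [filter_insert, if_pos hx, card_insert_of_notMem]
  intro h
  exact lt_irrefl _ (hb b (mem_filter.1 h).1)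

theorem card_filter_insert_max {s : Finset ℕ} {b x : ℕ} (hx : x ≤ b) :
    #{y ∈ insert b s | y < x} = #{y ∈ s | y < x} := by
  rw [filter_insert, if_neg hx.not_gt]

theorem colWeight_insert_min (n : ℕ) (Q : ℕ → ℂ → Kˣ) (u : ℂ) {s : Finset ℕ} {b : ℕ}
    (hb : ∀ x ∈ s, b < x) :
    colWeight n Q u (insert b s) = zq n Q (b + 1) u * colWeight n Q (u - 1) s := by
  have hbs : b ∉ s := fun h => lt_irrefl _ (hb b h)
  rw [colWeight, prod_insert hbs, colWeight]
  congr 1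
  · have : #{y ∈ insert b s | y < b} = 0 := by
      rw [card_eq_zero, filter_eq_empty_iff]
      intro y hy
      rcases mem_insert.1 hy with rfl | hy
      · exact lt_irrefl _
      · exact (hb y hy).not_gt
    rw [this]
    simp
  · refine prod_congr rfl fun x hx => ?_
    rw [card_filter_insert_min hb (hb x hx)]
    congr 2
    push_cast
    ring

theorem colAdm_insert_max {n m : ℕ} (hm : m < n) {s : Finset ℕ}
    (hs : s ⊆ Ico (n - m) (n + m)) : ColAdm n (insert (n + m) s) ↔ ColAdm n s := by
  have hmem : ∀ x ∈ s, n - m ≤ x ∧ x < n + m := fun x hx => mem_Ico.1 (hs hx)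
  constructor
  · intro h x hx hxn hx'
    have := h x (mem_insert_of_mem hx) hxn (mem_insert_of_mem hx')
    have h1 := hmem x hx
    rwa [card_filter_insert_max (by omega), card_filter_insert_max (by omega)] at this
  · intro h x hx hxn hx'
    rcases mem_insert.1 hx with rfl | hx
    · omega
    have h1 := hmem x hx
    rcases mem_insert.1 hx' with hx' | hx'
    · omega
    rw [card_filter_insert_max (by omega), card_filter_insert_max (by omega)]
    exact h x hx hxn hx'

theorem colAdm_insert_min {n m : ℕ} (hm : m < n) {s : Finset ℕ}
    (hs : s ⊆ Ico (n - m) (n + m)) : ColAdm n (insert (n - (m + 1)) s) ↔ ColAdm n s := by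
  have hmem : ∀ x ∈ s, n - m ≤ x ∧ x < n + m := fun x hx => mem_Ico.1 (hs hx)
  have hlt : ∀ x ∈ s, n - (m + 1) < x := fun x hx => by have := hmem x hx; omega
  constructor
  · intro h x hx hxn hx'
    have := h x (mem_insert_of_mem hx) hxn (mem_insert_of_mem hx')
    rw [card_filter_insert_min hlt (hlt _ hx), card_filter_insert_min hlt (hlt _ hx')] at this
    omega
  · intro h x hx hxn hx'
    rcases mem_insert.1 hx with rfl | hx
    · rcases mem_insert.1 hx' with hx' | hx'
      · omega
      · have := hmem _ hx'
        omega
    rcases mem_insert.1 hx' with hx' | hx'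
    · have := hmem _ hx
      omega
    have := h x hx hxn hx'
    rw [card_filter_insert_min hlt (hlt _ hx), card_filter_insert_min hlt (hlt _ hx')]
    omega

theorem colAdm_insert_min_max {n m : ℕ} (hm : m < n) {s : Finset ℕ}
    (hs : s ⊆ Ico (n - m) (n + m)) :
    ColAdm n (insert (n - (m + 1)) (insert (n + m) s)) ↔ ColAdm n s ∧ #s + 1 ≤ m := by
  have hmem : ∀ x ∈ s, n - m ≤ x ∧ x < n + m := fun x hx => mem_Ico.1 (hs hx)
  have hlt : ∀ x ∈ insert (n + m) s, n - (m + 1) < x := fun x hx => by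
    rcases mem_insert.1 hx with rfl | hx
    · omega
    · have := hmem x hx
      omega
  have hpartner : 2 * n - 1 - (n - (m + 1)) = n + m := by omega
  have hpos : #{y ∈ insert (n - (m + 1)) (insert (n + m) s) | y < n - (m + 1)} = 0 := by
    rw [card_eq_zero, filter_eq_empty_iff]
    intro y hy
    rcases mem_insert.1 hy with rfl | hy
    · exact lt_irrefl _
    · exact (hlt y hy).not_gt
  have hpos' : #{y ∈ insert (n - (m + 1)) (insert (n + m) s) | y < n + m} = #s + 1 := by
    rw [card_filter_insert_min hlt (by omega), card_filter_insert_max le_rfl,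
      filter_true_of_mem fun x hx => (hmem x hx).2]
  constructor
  · intro h
    refine ⟨(colAdm_insert_max hm hs).1 fun x hx hxn hx' => ?_, ?_⟩
    · have := h x (mem_insert_of_mem hx) hxn (mem_insert_of_mem hx')
      rw [card_filter_insert_min hlt (hlt _ hx), card_filter_insert_min hlt (hlt _ hx')] at this
      omega
    · have := h (n - (m + 1)) (mem_insert_self _ _) (by omega) (by rw [hpartner]; simp)
      rw [hpartner, hpos, hpos'] at this
      omega
  · rintro ⟨h, hcard⟩ x hx hxn hx'
    rcases mem_insert.1 hx with rfl | hx
    · rw [hpartner, hpos, hpos']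
      omega
    rcases mem_insert.1 hx' with hx' | hx'
    · have := hlt _ hx
      rcases mem_insert.1 hx with rfl | hx
      · omega
      · have := hmem _ hx
        omega
    have := (colAdm_insert_max hm hs).2 h x hx hxn hx'
    rw [card_filter_insert_min hlt (hlt _ hx), card_filter_insert_min hlt (hlt _ hx')]
    omega

/-- The sum of the weights of the admissible columns of length `a` in the `m` innermost
pairs of letters. -/
def admSum (n : ℕ) (Q : ℕ → ℂ → Kˣ) (m : ℕ) (a : ℤ) (u : ℂ) : K :=
  ∑ s ∈ (Ico (n - m) (n + m)).powerset,
    if ColAdm n s ∧ (#s : ℤ) = a then colWeight n Q u s else 0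

theorem Ico_insert_ends {n m : ℕ} (hm : m < n) :
    Ico (n - (m + 1)) (n + (m + 1)) =
      insert (n - (m + 1)) (insert (n + m) (Ico (n - m) (n + m))) := by
  ext x
  simp only [mem_Ico, mem_insert]
  omega

theorem sum_powerset_Ico_ends {M : Type*} [AddCommMonoid M] {n m : ℕ} (hm : m < n)
    (F : Finset ℕ → M) :
    ∑ s ∈ (Ico (n - (m + 1)) (n + (m + 1))).powerset, F s =
      ∑ s ∈ (Ico (n - m) (n + m)).powerset,
        (F s + F (insert (n + m) s) + F (insert (n - (m + 1)) s)
          + F (insert (n - (m + 1)) (insert (n + m) s))) := by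
  have h1 : n + m ∉ Ico (n - m) (n + m) := by simp
  have h2 : n - (m + 1) ∉ insert (n + m) (Ico (n - m) (n + m)) := by
    simp only [mem_Ico, mem_insert]
    omega
  rw [Ico_insert_ends hm, sum_powerset_insert h2, sum_powerset_insert h1,
    sum_powerset_insert h1]
  simp only [sum_add_distrib]
  abel

theorem card_le_of_colAdm {n m : ℕ} (hm : m ≤ n) :
    ∀ s ⊆ Ico (n - m) (n + m), ColAdm n s → #s ≤ m := by
  induction m with
  | zero =>
    intro s hs _
    simpa using hs
  | succ m ih =>
    intro s hs hadm
    have hmn : m < n := hm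
    rw [Ico_insert_ends hmn] at hs
    set r := (s.erase (n - (m + 1))).erase (n + m) with hr
    have hrs : r ⊆ Ico (n - m) (n + m) := by
      intro x hx
      have hx1 := mem_erase.1 hx
      have hx2 := mem_erase.1 hx1.2
      have := hs hx2.2
      simp only [mem_insert] at this
      tauto
    have hne : n + m ≠ n - (m + 1) := by omega
    have hlo : n - (m + 1) ∉ r := by simp [hr]
    have hhi : n + m ∉ r := by simp [hr]
    by_cases hl : n - (m + 1) ∈ s <;> by_cases hh : n + m ∈ s
    · have e : s = insert (n - (m + 1)) (insert (n + m) r) := by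
        rw [hr, insert_erase (mem_erase.2 ⟨hne, hh⟩), insert_erase hl]
      rw [e] at hadm ⊢
      have := (colAdm_insert_min_max hmn hrs).1 hadm
      have h1 := card_insert_le (n - (m + 1)) (insert (n + m) r)
      have h2 := card_insert_le (n + m) r
      omega
    · have e : s = insert (n - (m + 1)) r := by
        rw [hr, erase_eq_of_notMem (fun h => hh (mem_erase.1 h).2), insert_erase hl]
      rw [e] at hadm ⊢
      have := ih hmn.le r hrs ((colAdm_insert_min hmn hrs).1 hadm)
      have h1 := card_insert_le (n - (m + 1)) r
      omega
    · have e : s = insert (n + m) r := by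
        rw [hr, erase_eq_of_notMem hl, insert_erase hh]
      rw [e] at hadm ⊢
      have := ih hmn.le r hrs ((colAdm_insert_max hmn hrs).1 hadm)
      have h1 := card_insert_le (n + m) r
      omega
    · have e : s = r := by
        rw [hr, erase_eq_of_notMem hl, erase_eq_of_notMem hh]
      rw [e] at hadm ⊢
      have := ih hmn.le r hrs hadm
      omega

theorem admSum_eq_zero (n : ℕ) (Q : ℕ → ℂ → Kˣ) {m : ℕ} (hm : m ≤ n) {a : ℤ}
    (ha : (m : ℤ) < a) (u : ℂ) : admSum n Q m a u = 0 := by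
  refine sum_eq_zero fun s hs => if_neg ?_
  rintro ⟨hadm, hcard⟩
  have := card_le_of_colAdm hm s (mem_powerset.1 hs) hadm
  omega

theorem admSum_succ (n : ℕ) (Q : ℕ → ℂ → Kˣ) {m : ℕ} (hm : m < n) {a : ℤ}
    (ha : a ≤ m + 1) (u : ℂ) :
    admSum n Q (m + 1) a u =
      admSum n Q m a u + zq n Q (n - m) u * admSum n Q m (a - 1) (u - 1)
      + admSum n Q m (a - 1) u * zq n Q (n + m + 1) (u - a + 1)
      + zq n Q (n - m) u * admSum n Q m (a - 2) (u - 1)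
        * zq n Q (n + m + 1) (u - a + 1) := by
  unfold admSum
  rw [sum_powerset_Ico_ends hm]
  simp only [mul_sum, sum_mul, ← sum_add_distrib]
  refine sum_congr rfl fun s hs => ?_
  have hs := mem_powerset.1 hs
  have hmem : ∀ x ∈ s, n - m ≤ x ∧ x < n + m := fun x hx => mem_Ico.1 (hs hx)
  have hmax : ∀ x ∈ s, x < n + m := fun x hx => (hmem x hx).2
  have hmin : ∀ x ∈ s, n - (m + 1) < x := fun x hx => by have := hmem x hx; omega
  have hmin' : ∀ x ∈ insert (n + m) s, n - (m + 1) < x := fun x hx => by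
    rcases mem_insert.1 hx with rfl | hx
    · omega
    · exact hmin x hx
  have c1 : #(insert (n + m) s) = #s + 1 :=
    card_insert_of_notMem fun h => lt_irrefl _ (hmax _ h)
  have c2 : #(insert (n - (m + 1)) s) = #s + 1 :=
    card_insert_of_notMem fun h => lt_irrefl _ (hmin _ h)
  have c3 : #(insert (n - (m + 1)) (insert (n + m) s)) = #s + 2 := by
    rw [card_insert_of_notMem fun h => lt_irrefl _ (hmin' _ h), c1]
  have e : n - (m + 1) + 1 = n - m := by omega
  rw [colAdm_insert_max hm hs, colAdm_insert_min hm hs, colAdm_insert_min_max hm hs, c1, c2, c3,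
    colWeight_insert_min n Q u hmin', colWeight_insert_min n Q u hmin,
    colWeight_insert_max n Q u hmax, colWeight_insert_max n Q (u - 1) hmax, e]
  push_cast
  by_cases hadm : ColAdm n s
  swap
  · simp [hadm]
  by_cases h0 : (#s : ℤ) = a
  · rw [if_pos ⟨hadm, h0⟩, if_neg (by omega), if_neg (by omega), if_neg (by omega),
      if_neg (by omega), if_neg (by omega), if_neg (by omega)]
    ring
  by_cases h1 : (#s : ℤ) = a - 1
  · have ha' : (#s : ℂ) = (a : ℂ) - 1 := by exact_mod_cast congrArg (Int.cast : ℤ → ℂ) h1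
    rw [if_neg (by omega), if_pos ⟨hadm, by omega⟩, if_pos ⟨hadm, by omega⟩, if_neg (by omega),
      if_pos ⟨hadm, h1⟩, if_pos ⟨hadm, h1⟩, if_neg (by omega), ha',
      show u - ((a : ℂ) - 1) = u - a + 1 by ring]
    ring
  by_cases h2 : (#s : ℤ) = a - 2
  · have ha' : (#s : ℂ) = (a : ℂ) - 2 := by exact_mod_cast congrArg (Int.cast : ℤ → ℂ) h2
    rw [if_neg (by omega), if_neg (by omega), if_neg (by omega),
      if_pos ⟨⟨hadm, by omega⟩, by omega⟩, if_neg (by omega), if_neg (by omega),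
      if_pos ⟨hadm, h2⟩, ha', show u - 1 - ((a : ℂ) - 2) = u - a + 1 by ring]
    ring
  · rw [if_neg (by omega), if_neg (by omega), if_neg (by omega), if_neg (by omega),
      if_neg (by omega), if_neg (by omega), if_neg (by omega)]
    ring

theorem elemQ_eq_admSum (n : ℕ) (Q : ℕ → ℂ → Kˣ) (m : ℕ) (hm : m ≤ n) :
    ∀ (a : ℤ) (_ : a ≤ m + 1) (u : ℂ), elemQ n Q m a u = admSum n Q m a u := by
  induction m with
  | zero =>
    intro a ha u
    have hadm : ColAdm n ∅ := fun x hx => by simp at hx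
    by_cases h0 : a = 0
    · simp [elemQ, admSum, h0, hadm, colWeight]
    · have h2 : a ≠ 2 := by push_cast at ha; omega
      simp [elemQ, admSum, h0, h2, Ne.symm h0]
  | succ m ih =>
    intro a ha u
    have hmn : m < n := hm
    have ih' := ih hmn.le
    rcases ha.lt_or_eq with ha | rfl
    · push_cast at ha
      rw [admSum_succ n Q hmn (by omega), elemQ, ih' a (by omega), ih' (a - 1) (by omega),
        ih' (a - 1) (by omega), ih' (a - 2) (by omega)]
    · rw [elemQ_middle n Q _ hm, admSum_eq_zero n Q hm (by omega)]

theorem card_filter_image_lt {n a : ℕ} {t : Fin a → Fin (2 * n)} (ht : StrictMono t)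
    (k : Fin a) : #{y ∈ univ.image fun i => (t i : ℕ) | y < (t k : ℕ)} = k := by
  have hinj : Function.Injective fun i => (t i : ℕ) := fun i j h => ht.injective (Fin.ext h)
  rw [filter_image, card_image_of_injective _ hinj]
  have : (univ.filter fun i => (t i : ℕ) < (t k : ℕ)) = Iio k := by
    ext i
    simp only [mem_filter, mem_univ, true_and, mem_Iio]
    exact ht.lt_iff_lt
  rw [this, Fin.card_Iio]

theorem colAdm_image_iff {n a : ℕ} {t : Fin a → Fin (2 * n)} (ht : StrictMono t) :
    ColAdm n (univ.image fun i => (t i : ℕ)) ↔ AdmQ n t := by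
  constructor
  · intro h k l hk hl
    have e : 2 * n - 1 - (t k : ℕ) = t l := by omega
    have := h (t k) (mem_image_of_mem _ (mem_univ k)) (by omega)
      (e ▸ mem_image_of_mem (fun i => (t i : ℕ)) (mem_univ l))
    rw [e, card_filter_image_lt ht, card_filter_image_lt ht] at this
    omega
  · intro h x hx hxn hx'
    obtain ⟨k, -, rfl⟩ := mem_image.1 hx
    obtain ⟨l, -, hl⟩ := mem_image.1 hx'
    have := h k l (by omega) (by omega)
    rw [← hl, card_filter_image_lt ht, card_filter_image_lt ht]
    omega

theorem tabSumQ_eq_admSum (n : ℕ) (Q : ℕ → ℂ → Kˣ) (a : ℕ) (v : ℂ) :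
    tabSumQ n Q a v = admSum n Q n a (v + (a : ℂ) / 2 - 1) := by
  unfold tabSumQ admSum
  rw [← sum_filter]
  refine sum_nbij (fun t => univ.image fun i => (t i : ℕ)) ?_ ?_ ?_ ?_
  · intro t ht
    obtain ⟨-, hmono, hadm⟩ := mem_filter.1 ht
    have hinj : Function.Injective fun i => (t i : ℕ) :=
      fun i j h => hmono.injective (Fin.ext h)
    refine mem_filter.2 ⟨mem_powerset.2 fun x hx => ?_, (colAdm_image_iff hmono).2 hadm, ?_⟩
    · obtain ⟨k, -, rfl⟩ := mem_image.1 hx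
      have := (t k).2
      rw [mem_Ico]
      omega
    · rw [card_image_of_injective _ hinj, card_univ, Fintype.card_fin]
  · intro t ht t' ht' h
    have hmono := (mem_filter.1 ht).2.1
    have hmono' := (mem_filter.1 ht').2.1
    have hval : StrictMono fun i => (t i : ℕ) := hmono
    have hval' : StrictMono fun i => (t' i : ℕ) := hmono'
    have hr : Set.range (fun i => (t i : ℕ)) = Set.range fun i => (t' i : ℕ) := by
      have := congrArg (fun s : Finset ℕ => (s : Set ℕ)) h
      simpa using this
    have := (hval.range_inj hval').1 hr
    exact funext fun i => Fin.ext (congrFun this i)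
  · intro s hs
    obtain ⟨hsub, hadm, hcard⟩ := mem_filter.1 hs
    have hcard : #s = a := by exact_mod_cast hcard
    have hlt : ∀ i, s.orderEmbOfFin hcard i < 2 * n := fun i => by
      have := mem_Ico.1 (mem_powerset.1 hsub (s.orderEmbOfFin_mem hcard i))
      omega
    let t : Fin a → Fin (2 * n) := fun i => ⟨s.orderEmbOfFin hcard i, hlt i⟩
    have hmono : StrictMono t := fun i j hij => (s.orderEmbOfFin hcard).strictMono hij
    have him : (univ.image fun i => (t i : ℕ)) = s := by
      rw [← coe_inj, coe_image, coe_univ, Set.image_univ]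
      exact range_orderEmbOfFin s hcard
    refine ⟨t, mem_filter.2 ⟨mem_univ _, hmono, ?_⟩, him⟩
    rw [← colAdm_image_iff hmono, him]
    exact hadm
  · intro t ht
    have hmono := (mem_filter.1 ht).2.1
    have hinj : Function.Injective fun i => (t i : ℕ) :=
      fun i j h => hmono.injective (Fin.ext h)
    rw [colWeight, prod_image fun i _ j _ h => hinj h]
    refine prod_congr rfl fun k _ => ?_
    rw [card_filter_image_lt hmono]
    congr 2
    ring

theorem T1q_eq_elemQ (n : ℕ) (Q : ℕ → ℂ → Kˣ) {a : ℕ} (ha : a ≤ 2 * n + 2) (u : ℂ) :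
    T1q n Q a (u + (a : ℂ) / 2) = elemQ n Q n a (u + a - 1) := by
  rw [T1q, if_neg (by omega)]
  split_ifs with h1 h2 h3
  · rw [Int.toNat_natCast, tabSumQ_eq_admSum, elemQ_eq_admSum n Q n le_rfl _ (by omega)]
    congr 1
    ring
  · rw [h2, elemQ_middle n Q n le_rfl]
  · obtain ⟨b, hb⟩ : ∃ b, a + b = 2 * n + 2 := ⟨2 * n + 2 - a, by omega⟩
    have e : 2 * (n : ℤ) + 2 - a = b := by omega
    have e' : (a : ℤ) = 2 * (n : ℤ) + 2 - b := by omega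
    have ec : (a : ℂ) = 2 * n + 2 - b := by exact_mod_cast congrArg (Int.cast : ℤ → ℂ) e'
    have s := elemQ_antisymm n Q n le_rfl b (u + a - 1)
    rw [Nat.sub_self, shiftedY_zero, shiftedY_zero, Units.val_one, mul_one, mul_one, ← e'] at s
    rw [e, Int.toNat_natCast, tabSumQ_eq_admSum, s,
      elemQ_eq_admSum n Q n le_rfl _ (by omega)]
    congr 2
    rw [ec]
    push_cast
    ring
  · omega

/-- The `T-Q` relation: `∑_{a=0}^{N} (-1)^a Q_1(u+a) T^{(a)}_1(u+a/2) = 0`. -/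
theorem statement7 {K : Type*} [CommRing K] (n : ℕ) (hn : 2 ≤ n) (Q : ℕ → ℂ → Kˣ)
    (u : ℂ) :
    ∑ a ∈ Finset.range (2 * n + 3),
      (-1 : K) ^ a * (Q 1 (u + (a : ℂ)) : K) * T1q n Q a (u + (a : ℂ) / 2) = 0 := by
  obtain ⟨m, rfl⟩ : ∃ m, n = m + 1 := ⟨n - 1, by omega⟩
  let B : ℤ → ℂ → K := fun a w => elemQ (m + 1) Q m a w
    + elemQ (m + 1) Q m (a - 1) w * zq (m + 1) Q (m + 1 + m + 1) (w - a + 1)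
  let G : ℕ → K := fun a => (-1) ^ a * Q 1 (u + a - 1) * B (a - 1) (u + a - 2)
  have hz : ∀ w, (Q 1 (w + 1) : K) * (zq (m + 1) Q 1 w : K) = Q 1 w := fun w => by
    have h1 : m ≠ 0 := by omega
    have e1 : w + 1 / 2 - 2⁻¹ = w := by ring
    have e2 : w + 1 / 2 + 2⁻¹ = w + 1 := by ring
    simp [zq, Yq, h1, e1, e2, -one_div, mul_left_comm]
  have hterm : ∀ a ∈ range (2 * (m + 1) + 3),
      (-1 : K) ^ a * (Q 1 (u + (a : ℂ)) : K) * T1q (m + 1) Q a (u + (a : ℂ) / 2)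
        = G a - G (a + 1) := by
    intro a ha
    have h := hz (u + a - 1)
    rw [show u + (a : ℂ) - 1 + 1 = u + a by ring] at h
    rw [T1q_eq_elemQ _ Q (by have := mem_range.1 ha; omega), elemQ,
      show m + 1 - m = 1 by omega]
    simp only [G, B]
    rw [← h]
    push_cast
    rw [show u + ((a : ℂ) + 1) - 1 = u + a by ring, show u + ((a : ℂ) + 1) - 2 = u + a - 1 by ring,
      show (a : ℤ) + 1 - 1 = a by ring, show (a : ℤ) - 1 - 1 = a - 2 by ring,
      show u + (a : ℂ) - 1 - 1 = u + a - 2 by ring,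
      show u + (a : ℂ) - 2 - ((a : ℂ) - 1) + 1 = u + a - 1 - a + 1 by ring,
      show u + (a : ℂ) - 1 - ((a : ℂ) + 1 - 1) + 1 = u + a - 1 - a + 1 by ring, pow_succ]
    ring
  rw [sum_congr rfl hterm, sum_range_sub']
  simp only [G, B]
  rw [elemQ_of_neg _ _ _ _ (by omega), elemQ_of_neg _ _ _ _ (by omega),
    elemQ_of_gt _ _ _ _ (by push_cast; omega), elemQ_of_gt _ _ _ _ (by push_cast; omega)]
  ring
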